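/- arXiv:2502.07770 — 2 statements merged into one kernel-verified Lean document; each statement's English description precedes it below -/
import Mathlib

section
/- (Gaussian smoothing identity.) Let d ≥ 1, σ > 0, σ_γ > 0, and let q(γ) = (2π·σ_γ²)^{−d} · exp(−|γ|²/(2σ_γ²)) be a probability density on ℂᵈ ≅ ℝ²ᵈ. Then for all β, β̃ ∈ ℂᵈ: ∫_{ℂᵈ} q(γ) · exp(−(|β−γ|² + |β̃−γ|²)/(2σ²)) dγ = (1 + 2σ_γ²/σ²)^{−d} · exp(−(|β|² + |β̃|²)/(2(σ² + 2σ_γ²))) · exp(−σ_γ²·|β − β̃|²/(2σ²·(σ² + 2σ_γ²))). -/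
open MeasureTheory

/-- squared Euclidean norm `|α|² = ∑ j |α j|²` on ℂᵈ. -/
noncomputable def nsq {d : ℕ} (α : Fin d → ℂ) : ℝ :=
  ∑ j, Complex.normSq (α j)

theorem integral_exp_neg_mul_normSq {a : ℝ} (ha : 0 < a) :
    ∫ z : ℂ, Real.exp (-a * Complex.normSq z) = Real.pi / a := by
  simpa [Complex.normSq_eq_norm_sq] using
    GaussianFourier.integral_rexp_neg_mul_sq_norm (V := ℂ) ha

theorem integral_exp_neg_mul_nsq {d : ℕ} {a : ℝ} (ha : 0 < a) :
    ∫ γ : Fin d → ℂ, Real.exp (-a * nsq γ) = (Real.pi / a) ^ d := by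
  simp_rw [nsq, Finset.mul_sum, Real.exp_sum]
  rw [integral_fintype_prod_volume_eq_prod (fun _ z => Real.exp (-a * Complex.normSq z))]
  simp only [integral_exp_neg_mul_normSq ha, Finset.prod_const, Finset.card_univ, Fintype.card_fin]

/-- Completing the square in the combined exponent of the three Gaussian factors. -/
theorem nsq_complete_square {d : ℕ} {s t : ℝ} (hs : 0 < s) (ht : 0 < t)
    (β βt γ : Fin d → ℂ) :
    -(nsq γ) / (2 * t ^ 2) + -(nsq (β - γ) + nsq (βt - γ)) / (2 * s ^ 2) =
      -(nsq β + nsq βt) / (2 * (s ^ 2 + 2 * t ^ 2)) +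
        -(t ^ 2 * nsq (β - βt)) / (2 * s ^ 2 * (s ^ 2 + 2 * t ^ 2)) +
        -((s ^ 2 + 2 * t ^ 2) / (2 * t ^ 2 * s ^ 2)) *
          nsq (γ - ((t ^ 2 / (s ^ 2 + 2 * t ^ 2) : ℝ) : ℂ) • (β + βt)) := by
  have h : s ^ 2 + 2 * t ^ 2 ≠ 0 := by positivity
  simp only [nsq, Finset.mul_sum, ← Finset.sum_add_distrib, ← Finset.sum_neg_distrib,
    Finset.sum_div]
  refine Finset.sum_congr rfl fun j _ => ?_
  simp only [Complex.normSq_apply, Pi.sub_apply, Pi.add_apply, Pi.smul_apply, smul_eq_mul,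
    Complex.sub_re, Complex.sub_im, Complex.add_re, Complex.add_im, Complex.re_ofReal_mul,
    Complex.im_ofReal_mul]
  field_simp
  ring

/-- Gaussian smoothing identity: averaging the product of two Gaussian
peak profiles of width `σ` centered at a random location `γ ~ N(0, σ_γ² per real
coordinate)` over `γ ∈ ℂᵈ`. -/
theorem gaussian_smoothing_identity (d : ℕ) (hd : 1 ≤ d) (σ σγ : ℝ)
    (hσ : 0 < σ) (hσγ : 0 < σγ) (β βt : Fin d → ℂ) :
    (∫ γ : Fin d → ℂ,
        ((2 * Real.pi * σγ ^ 2) ^ d)⁻¹ * Real.exp (-(nsq γ) / (2 * σγ ^ 2)) *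
          Real.exp (-((nsq (β - γ)) + nsq (βt - γ)) / (2 * σ ^ 2)))
      = ((1 + 2 * σγ ^ 2 / σ ^ 2) ^ d)⁻¹
        * Real.exp (-((nsq β) + nsq βt) / (2 * (σ ^ 2 + 2 * σγ ^ 2)))
        * Real.exp (-(σγ ^ 2 * nsq (β - βt)) / (2 * σ ^ 2 * (σ ^ 2 + 2 * σγ ^ 2))) := by
  set a : ℝ := (σ ^ 2 + 2 * σγ ^ 2) / (2 * σγ ^ 2 * σ ^ 2) with ha
  have ha_pos : 0 < a := by positivity
  simp_rw [mul_assoc, ← Real.exp_add, ← mul_assoc, nsq_complete_square hσ hσγ β βt, ← ha]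
  simp_rw [Real.exp_add _ (-a * _)]
  rw [integral_const_mul, integral_const_mul,
    integral_sub_right_eq_self (fun γ : Fin d → ℂ => Real.exp (-a * nsq γ)),
    integral_exp_neg_mul_nsq ha_pos, Real.exp_add]
  have hpow : ((2 * Real.pi * σγ ^ 2) ^ d)⁻¹ * (Real.pi / a) ^ d =
      ((1 + 2 * σγ ^ 2 / σ ^ 2) ^ d)⁻¹ := by
    rw [← inv_pow, ← inv_pow, ← mul_pow, ha]
    congr 1
    field_simp
  rw [← hpow]
  ring
end

section
/- (Concentration of the peak location.) Let m, n ≥ 1 with m·n ≥ 8, let κ > 0, set σ_γ² = 0.99·κ/2, and let σ > 0 satisfy 2σ² ≤ 0.99·κ. Let γ be a random vector in ℂ^{mn} whose 2mn real coordinates are independent centered Gaussian random variables each of variance σ_γ². Then Pr(2σ² < |γ|² ≤ κ·m·n) ≥ 0.49987. -/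
open MeasureTheory

/-- The Poisson law of integer mean `n` gives at most half of its mass to `{0, …, n - 1}`. -/
theorem sum_range_pow_self_div_factorial_le (n : ℕ) :
    ∑ k ∈ Finset.range n, (n : ℝ) ^ k / (k.factorial : ℝ) ≤ Real.exp n / 2 := by
  have hfact : ∀ j, j < n → (n + j).factorial ≤ n ^ (2 * j + 1) * (n - 1 - j).factorial := by
    intro j
    induction j with
    | zero =>
      intro h
      obtain ⟨k, rfl⟩ : ∃ k, n = k + 1 := ⟨n - 1, by omega⟩
      simp [Nat.factorial_succ]
    | succ j ih =>
      intro h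
      obtain ⟨k, rfl⟩ : ∃ k, n = k + j + 2 := ⟨n - j - 2, by omega⟩
      have e1 : k + j + 2 - 1 - j = k + 1 := by omega
      have e2 : k + j + 2 - 1 - (j + 1) = k := by omega
      have := ih (by omega)
      rw [e1, Nat.factorial_succ] at this
      rw [e2, ← add_assoc, Nat.factorial_succ]
      calc (k + j + 2 + j + 1) * (k + j + 2 + j).factorial
          ≤ (k + j + 2 + j + 1) * ((k + j + 2) ^ (2 * j + 1) * ((k + 1) * k.factorial)) := by
            gcongr
        _ = ((k + j + 2 + j + 1) * (k + 1)) * ((k + j + 2) ^ (2 * j + 1) * k.factorial) := by ring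
        _ ≤ (k + j + 2) ^ 2 * ((k + j + 2) ^ (2 * j + 1) * k.factorial) := by
            gcongr
            nlinarith
        _ = _ := by ring
  have hle : ∑ k ∈ Finset.range n, (n : ℝ) ^ k / (k.factorial : ℝ)
      ≤ ∑ k ∈ Finset.range n, (n : ℝ) ^ (n + k) / ((n + k).factorial : ℝ) := by
    rw [← Finset.sum_range_reflect]
    refine Finset.sum_le_sum fun j hj => ?_
    rw [Finset.mem_range] at hj
    rw [div_le_div_iff₀ (by positivity) (by positivity)]
    have h : ((n + j).factorial : ℝ) ≤ (n : ℝ) ^ (2 * j + 1) * ((n - 1 - j).factorial : ℝ) := by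
      exact_mod_cast hfact j hj
    calc (n : ℝ) ^ (n - 1 - j) * ((n + j).factorial : ℝ)
        ≤ (n : ℝ) ^ (n - 1 - j) * ((n : ℝ) ^ (2 * j + 1) * ((n - 1 - j).factorial : ℝ)) := by
          gcongr
      _ = (n : ℝ) ^ (n - 1 - j + (2 * j + 1)) * ((n - 1 - j).factorial : ℝ) := by ring
      _ = _ := by
          congr 2
          omega
  have htot := Real.sum_le_exp_of_nonneg (Nat.cast_nonneg n : (0 : ℝ) ≤ n) (n + n)
  rw [Finset.sum_range_add] at htot
  linarith

/-- The tail of the Gamma law of shape `d + 1` is an antiderivative of minus its density. -/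
theorem hasDerivAt_exp_neg_mul_sum (d : ℕ) (x : ℝ) :
    HasDerivAt (fun x : ℝ => Real.exp (-x) * ∑ k ∈ Finset.range (d + 1), x ^ k / (k.factorial : ℝ))
      (-(Real.exp (-x) * (x ^ d / (d.factorial : ℝ)))) x := by
  induction d with
  | zero => simpa using (hasDerivAt_neg x).exp
  | succ d ih =>
    have h := ih.add ((hasDerivAt_neg x).exp.mul
      ((hasDerivAt_pow (d + 1) x).div_const ((d + 1).factorial : ℝ)))
    refine (h.congr_of_eventuallyEq (.of_forall fun y => ?_)).congr_deriv ?_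
    · rw [Finset.sum_range_succ]
      simp [mul_add]
    · rw [Nat.factorial_succ]
      push_cast
      field_simp
      simp

theorem measurable_nsq {d : ℕ} : Measurable (nsq : (Fin d → ℂ) → ℝ) := by
  unfold nsq
  exact Finset.measurable_sum _ fun j _ =>
    Complex.continuous_normSq.measurable.comp (measurable_pi_apply j)

theorem volume_nsq_le (d : ℕ) {r : ℝ} (hr : 0 ≤ r) :
    volume {γ : Fin (d + 1) → ℂ | nsq γ ≤ r}
      = ENNReal.ofReal (Real.pi ^ (d + 1) * r ^ (d + 1) / ((d + 1).factorial : ℝ)) := by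
  have h := Complex.volume_sum_rpow_le (Fin (d + 1)) (p := 2) (by norm_num) (Real.sqrt r)
  have hset : {x : Fin (d + 1) → ℂ | (∑ i, ‖x i‖ ^ (2 : ℝ)) ^ (1 / (2 : ℝ)) ≤ Real.sqrt r}
      = {γ | nsq γ ≤ r} := by
    ext x
    simp only [Set.mem_ofPred_eq, ← Real.sqrt_eq_rpow, nsq, Complex.normSq_eq_norm_sq,
      Real.rpow_two]
    exact Real.sqrt_le_sqrt_iff hr
  have hG : Real.Gamma (2 * (Fintype.card (Fin (d + 1)) : ℝ) / 2 + 1)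
      = ((d + 1).factorial : ℝ) := by
    rw [← Real.Gamma_nat_eq_factorial]
    simp
  have hG2 : Real.Gamma (2 / 2 + 1) = 1 := by norm_num [Real.Gamma_two]
  rw [hset, hG, hG2, ← ENNReal.ofReal_pow (Real.sqrt_nonneg r), pow_mul, Real.sq_sqrt hr,
    ← ENNReal.ofReal_mul (by positivity), Fintype.card_fin] at h
  rw [h]
  congr 1
  ring

theorem volume_nsq_mem_Ioc (d : ℕ) {a b : ℝ} (ha : 0 ≤ a) (hab : a ≤ b) :
    volume {γ : Fin (d + 1) → ℂ | nsq γ ∈ Set.Ioc a b}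
      = ENNReal.ofReal (∫ t in a..b, Real.pi ^ (d + 1) * t ^ d / (d.factorial : ℝ)) := by
  have hset : {γ : Fin (d + 1) → ℂ | nsq γ ∈ Set.Ioc a b}
      = {γ | nsq γ ≤ b} \ {γ | nsq γ ≤ a} := by
    ext x
    simp [and_comm]
  have hsub : {γ : Fin (d + 1) → ℂ | nsq γ ≤ a} ⊆ {γ | nsq γ ≤ b} := fun x hx => le_trans hx hab
  have hmeas : MeasurableSet {γ : Fin (d + 1) → ℂ | nsq γ ≤ a} :=
    measurableSet_le measurable_nsq measurable_const
  rw [hset, measure_sdiff hsub hmeas.nullMeasurableSet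
    (by rw [volume_nsq_le d ha]; exact ENNReal.ofReal_ne_top),
    volume_nsq_le d ha, volume_nsq_le d (ha.trans hab), ← ENNReal.ofReal_sub _ (by positivity)]
  congr 1
  rw [intervalIntegral.integral_div, intervalIntegral.integral_const_mul, integral_pow,
    Nat.factorial_succ]
  push_cast
  field_simp

/-- The law of the squared norm under Lebesgue measure on `ℂ^(d+1)`, away from the origin. -/
theorem map_nsq_restrict_Ioi (d : ℕ) :
    ((volume : Measure (Fin (d + 1) → ℂ)).map nsq).restrict (Set.Ioi 0)
      = (volume.restrict (Set.Ioi 0)).withDensity fun t : ℝ =>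
          ENNReal.ofReal (Real.pi ^ (d + 1) * t ^ d / (d.factorial : ℝ)) := by
  have key : ∀ a b : ℝ,
      (((volume : Measure (Fin (d + 1) → ℂ)).map nsq).restrict (Set.Ioi 0)) (Set.Ioc a b)
        = volume {γ : Fin (d + 1) → ℂ | nsq γ ∈ Set.Ioc (a ⊔ 0) b} := by
    intro a b
    rw [Measure.restrict_apply measurableSet_Ioc, Set.Ioc_inter_Ioi,
      Measure.map_apply measurable_nsq measurableSet_Ioc]
    rfl
  refine Measure.ext_of_Ioc' _ _ (fun a b _ => ?_) (fun a b _ => ?_)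
  · rw [key]
    rcases le_total (a ⊔ 0) b with h | h
    · rw [volume_nsq_mem_Ioc d le_sup_right h]
      exact ENNReal.ofReal_ne_top
    · simp [Set.Ioc_eq_empty_of_le h]
  · rw [key, withDensity_apply _ measurableSet_Ioc, Measure.restrict_restrict measurableSet_Ioc,
      Set.Ioc_inter_Ioi]
    rcases le_total (a ⊔ 0) b with h | h
    · rw [volume_nsq_mem_Ioc d le_sup_right h, intervalIntegral.integral_of_le h,
        ofReal_integral_eq_lintegral_ofReal]
      · exact (Continuous.intervalIntegrable (by fun_prop) _ _).1
      · refine (ae_restrict_iff' measurableSet_Ioc).2 (ae_of_all _ fun t ht => ?_)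
        have : 0 ≤ t := (le_sup_right.trans_lt ht.1).le
        simp only [Pi.zero_apply]
        positivity
    · simp [Set.Ioc_eq_empty_of_le h]

/-- The squared norm of a centered isotropic complex Gaussian vector follows a scaled Gamma law. -/
theorem gaussian_nsq_mem_Ioc (d : ℕ) {s a b : ℝ} (hs : 0 < s) (ha : 0 ≤ a) (hab : a ≤ b) :
    (volume.withDensity fun γ : Fin (d + 1) → ℂ =>
        ENNReal.ofReal (((Real.pi * s) ^ (d + 1))⁻¹ * Real.exp (-(nsq γ) / s)))
      {γ : Fin (d + 1) → ℂ | nsq γ ∈ Set.Ioc (s * a) (s * b)}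
      = ENNReal.ofReal
          (Real.exp (-a) * ∑ k ∈ Finset.range (d + 1), a ^ k / (k.factorial : ℝ)
            - Real.exp (-b) * ∑ k ∈ Finset.range (d + 1), b ^ k / (k.factorial : ℝ)) := by
  have hsab : s * a ≤ s * b := by gcongr
  have hsa : 0 ≤ s * a := by positivity
  set g : ℝ → ENNReal := fun t =>
    ENNReal.ofReal (((Real.pi * s) ^ (d + 1))⁻¹ * Real.exp (-t / s)) with hg
  have hgm : Measurable g := by fun_prop
  have hI : Set.Ioc (s * a) (s * b) ⊆ Set.Ioi 0 := fun t ht => hsa.trans_lt ht.1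
  have hderiv : ∀ t : ℝ, HasDerivAt
      (fun t : ℝ => -(Real.exp (-(t / s)) *
        ∑ k ∈ Finset.range (d + 1), (t / s) ^ k / (k.factorial : ℝ)))
      (Real.pi ^ (d + 1) * t ^ d / (d.factorial : ℝ)
        * (((Real.pi * s) ^ (d + 1))⁻¹ * Real.exp (-t / s))) t := by
    intro t
    have h := ((hasDerivAt_exp_neg_mul_sum d (t / s)).comp t
      ((hasDerivAt_id t).div_const s)).neg
    refine h.congr_deriv ?_
    rw [neg_div, div_pow]
    have := Real.pi_pos
    field_simp
    ring
  change (volume.withDensity fun γ : Fin (d + 1) → ℂ => g (nsq γ))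
    (nsq ⁻¹' Set.Ioc (s * a) (s * b)) = _
  rw [withDensity_apply _ (measurable_nsq measurableSet_Ioc)]
  change ∫⁻ γ in nsq ⁻¹' Set.Ioc (s * a) (s * b), g (nsq γ) = _
  rw [← setLIntegral_map measurableSet_Ioc hgm measurable_nsq,
    ← Set.inter_eq_left.2 hI, ← Measure.restrict_restrict measurableSet_Ioc,
    map_nsq_restrict_Ioi, setLIntegral_withDensity_eq_setLIntegral_mul _ (by fun_prop) hgm
      measurableSet_Ioc, Measure.restrict_restrict measurableSet_Ioc, Set.inter_eq_left.2 hI]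
  have hint := intervalIntegral.integral_eq_sub_of_hasDerivAt (a := s * a) (b := s * b)
    (fun t _ => hderiv t) (Continuous.intervalIntegrable (by fun_prop) _ _)
  rw [mul_div_cancel_left₀ _ hs.ne', mul_div_cancel_left₀ _ hs.ne', neg_sub_neg] at hint
  rw [← hint, intervalIntegral.integral_of_le hsab, ofReal_integral_eq_lintegral_ofReal]
  · refine setLIntegral_congr_fun measurableSet_Ioc fun t ht => ?_
    have : 0 ≤ t := (hI ht).le
    simp only [Pi.mul_apply, hg]
    rw [← ENNReal.ofReal_mul (by positivity)]
  · exact (Continuous.intervalIntegrable (by fun_prop) _ _).1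
  · refine (ae_restrict_iff' measurableSet_Ioc).2 (ae_of_all _ fun t ht => ?_)
    have : 0 ≤ t := (hI ht).le
    have := Real.pi_pos
    simp only [Pi.zero_apply]
    positivity

/-- concentration of the peak location: if `γ ∈ ℂ^{mn}` has `2mn`
independent centered Gaussian real coordinates of variance `σ_γ² = 0.99κ/2` each, and
`2σ² ≤ 0.99κ`, then `Pr(2σ² < |γ|² ≤ κmn) ≥ 0.49987`. -/
theorem peak_location_concentration (m n : ℕ) (hm : 1 ≤ m) (hn : 1 ≤ n)
    (hmn : 8 ≤ m * n) (κ σ σγsq : ℝ) (hκ : 0 < κ) (hσγ : σγsq = 0.99 * κ / 2)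
    (hσ : 0 < σ) (hσκ : 2 * σ ^ 2 ≤ 0.99 * κ) :
    ENNReal.ofReal 0.49987
      ≤ (volume.withDensity fun γ : Fin (m * n) → ℂ =>
            ENNReal.ofReal (((2 * Real.pi * σγsq) ^ (m * n))⁻¹
              * Real.exp (-(nsq γ) / (2 * σγsq))))
          {γ : Fin (m * n) → ℂ | 2 * σ ^ 2 < nsq γ ∧ nsq γ ≤ κ * (m : ℝ) * (n : ℝ)} := by
  have hcast : κ * (m : ℝ) * (n : ℝ) = κ * ((m * n : ℕ) : ℝ) := by push_cast; ring
  rw [hcast]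
  generalize m * n = N at hmn ⊢
  obtain ⟨d, rfl⟩ : ∃ d, N = d + 1 := ⟨N - 1, by omega⟩
  have hs : 0 < 2 * σγsq := by rw [hσγ]; positivity
  have hN : (1 : ℝ) ≤ ((d + 1 : ℕ) : ℝ) := by exact_mod_cast (by omega : 1 ≤ d + 1)
  have hG := gaussian_nsq_mem_Ioc d hs zero_le_one hN
  have hpi : 2 * Real.pi * σγsq = Real.pi * (2 * σγsq) := by ring
  rw [hpi]
  refine le_trans ?_ (measure_mono (s := {γ : Fin (d + 1) → ℂ |
    nsq γ ∈ Set.Ioc (2 * σγsq * 1) (2 * σγsq * ((d + 1 : ℕ) : ℝ))}) fun γ hγ => ?_)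
  · rw [hG]
    refine ENNReal.ofReal_le_ofReal ?_
    have hupper : Real.exp (-((d + 1 : ℕ) : ℝ)) * ∑ k ∈ Finset.range (d + 1),
        ((d + 1 : ℕ) : ℝ) ^ k / (k.factorial : ℝ) ≤ 1 / 2 := by
      calc _ ≤ Real.exp (-((d + 1 : ℕ) : ℝ)) * (Real.exp ((d + 1 : ℕ) : ℝ) / 2) := by
            gcongr
            exact sum_range_pow_self_div_factorial_le (d + 1)
        _ = 1 / 2 := by
            rw [← mul_div_assoc, ← Real.exp_add]
            simp
    have hlower : 0.99987 ≤ Real.exp (-1) * ∑ k ∈ Finset.range (d + 1),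
        (1 : ℝ) ^ k / (k.factorial : ℝ) := by
      have h8 : (2.71825 : ℝ) ≤ ∑ k ∈ Finset.range (d + 1), (1 : ℝ) ^ k / (k.factorial : ℝ) := by
        calc (2.71825 : ℝ) ≤ ∑ k ∈ Finset.range 8, (1 : ℝ) ^ k / (k.factorial : ℝ) := by
              norm_num [Finset.sum_range_succ, Nat.factorial]
          _ ≤ _ := Finset.sum_le_sum_of_subset_of_nonneg
              (Finset.range_subset_range.2 hmn) fun _ _ _ => by positivity
      rw [Real.exp_neg, inv_mul_eq_div, le_div_iff₀ (Real.exp_pos 1)]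
      linarith [Real.exp_one_lt_d9]
    linarith
  · obtain ⟨h1, h2⟩ := hγ
    constructor
    · linarith
    · refine h2.trans ?_
      gcongr
      linarith
end
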